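/- arXiv:2110.10523 — 5 statements merged into one kernel-verified Lean document; each statement's English description precedes it below -/
import Mathlib

section
/- Let n ≥ 3 and let s_0, …, s_n be the Boolean states of n+1 sensors. Suppose that the number of attacked sensors, i.e., the cardinality of {i ∈ {0,…,n} : s_i = true}, is at most n − 2. If e_{i,j,n} = true for all indices i < j < n, then s_n = true. (Lemma 2 of the paper.) -/
/-- Lemma 2 of the paper: if at most `n - 2` of the `n + 1` sensors are attacked and
every disparity error state `e_{i,j,n}` with `i < j < n` is `true`, then the
reference sensor `S_n` is attacked: `s n = true`. -/
theorem stmt_2 (n : ℕ) (hn : 3 ≤ n) (s : Fin (n + 1) → Bool)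
    (hcard : (Finset.univ.filter (fun i : Fin (n + 1) => s i = true)).card ≤ n - 2)
    (he : ∀ i j : Fin (n + 1), (i : ℕ) < (j : ℕ) → (j : ℕ) < n →
      (s i || s j || s (Fin.last n)) = true) :
    s (Fin.last n) = true := by
  by_contra hl
  have hsum := Finset.card_filter_add_card_filter_not (s := (Finset.univ : Finset (Fin (n + 1))))
    (fun i => s i = true)
  rw [Finset.card_univ, Fintype.card_fin] at hsum
  have h2 := Finset.pred_card_le_card_erase
    (s := Finset.univ.filter (fun i : Fin (n + 1) => ¬ s i = true)) (a := Fin.last n)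
  have h3 : 1 < ((Finset.univ.filter (fun i : Fin (n + 1) => ¬ s i = true)).erase
    (Fin.last n)).card := by omega
  obtain ⟨a, ha, b, hb, hab⟩ := Finset.one_lt_card.mp h3
  simp only [Finset.mem_erase, Finset.mem_filter, Finset.mem_univ, true_and] at ha hb
  have la : (a : ℕ) < n := Fin.val_lt_last ha.1
  have lb : (b : ℕ) < n := Fin.val_lt_last hb.1
  rcases lt_or_gt_of_ne (fun h => hab (Fin.ext h) : (a : ℕ) ≠ b) with h | h
  · have := he a b h lb
    simp_all
  · have := he b a h la
    simp_all
end

section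
/- Let n ≥ 3 and let s_0, …, s_n be the Boolean states of n+1 sensors. Suppose that the number of attacked sensors, i.e., the cardinality of {i ∈ {0,…,n} : s_i = true}, is at most n − 2, and that e_{i,j,n} = true for all indices i < j < n. Then the number of attacked sensors among S_0, …, S_{n−1}, i.e., the cardinality of {i ∈ {0,…,n−1} : s_i = true}, is at most (n−1) − 2. (This is the fact that makes the paper's recursive identification algorithm well-founded: after removing the reference sensor S_n, which must be attacked by Lemma 2, the remaining n-sensor system again satisfies the at-most-(size − 3)-attacked hypothesis.) -/
/-- Well-foundedness of the recursive identification algorithm: if at most `n - 2`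
of the `n + 1` sensors are attacked and every disparity error state `e_{i,j,n}` with
`i < j < n` is `true`, then at most `(n - 1) - 2` of the sensors `S_0, …, S_{n-1}`
are attacked. -/
theorem stmt_4 (n : ℕ) (hn : 3 ≤ n) (s : Fin (n + 1) → Bool)
    (hcard : (Finset.univ.filter (fun i : Fin (n + 1) => s i = true)).card ≤ n - 2)
    (he : ∀ i j : Fin (n + 1), (i : ℕ) < (j : ℕ) → (j : ℕ) < n →
      (s i || s j || s (Fin.last n)) = true) :
    (Finset.univ.filter (fun i : Fin (n + 1) => (i : ℕ) < n ∧ s i = true)).card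
      ≤ (n - 1) - 2 := by
  have hl : s (Fin.last n) = true := by
    by_contra hl
    have h1 := Finset.card_filter_add_card_filter_not
      (s := (Finset.univ : Finset (Fin (n + 1)))) (fun i => s i = true)
    rw [Finset.card_univ, Fintype.card_fin] at h1
    have h2 := Finset.pred_card_le_card_erase (a := Fin.last n)
      (s := Finset.univ.filter (fun i : Fin (n + 1) => ¬ s i = true))
    have h3 : 1 < ((Finset.univ.filter
        (fun i : Fin (n + 1) => ¬ s i = true)).erase (Fin.last n)).card := by omega
    obtain ⟨a, ha, b, hb, hab⟩ := Finset.one_lt_card.1 h3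
    simp only [Finset.mem_erase, Finset.mem_filter, Finset.mem_univ, true_and] at ha hb
    have ha' : (a : ℕ) < n := Fin.val_lt_last ha.1
    have hb' : (b : ℕ) < n := Fin.val_lt_last hb.1
    have hab' : (a : ℕ) ≠ b := fun h => hab (Fin.ext h)
    rcases lt_or_gt_of_ne hab' with h | h
    · have := he a b h hb'
      simp_all
    · have := he b a h ha'
      simp_all
  have hlt : (Finset.univ.filter (fun i : Fin (n + 1) => (i : ℕ) < n ∧ s i = true)).card
      < (Finset.univ.filter (fun i : Fin (n + 1) => s i = true)).card := by
    apply Finset.card_lt_card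
    rw [Finset.ssubset_iff_of_subset]
    · exact ⟨Fin.last n, by simp [hl], by simp⟩
    · intro i hi
      simp only [Finset.mem_filter, Finset.mem_univ, true_and] at hi ⊢
      exact hi.2
  omega
end

section
/- Let n ≥ 3 and let s and s' be two Boolean state vectors on the n+1 sensors S_0, …, S_n, each having at most n − 2 attacked sensors (i.e., the cardinality of {i : s_i = true} is at most n − 2, and likewise for s'). If for all indices i < j < k in {0, …, n} the corresponding disparity error states agree, i.e., s_i ∨ s_j ∨ s_k = s'_i ∨ s'_j ∨ s'_k, then s = s'. (The correctness of the paper's identification scheme: when no more than n − 2 sensors are attacked simultaneously, the collection of disparity error states uniquely determines which sensors are attacked.) -/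
theorem aux_false (n : ℕ) (hn : 3 ≤ n) (s s' : Fin (n + 1) → Bool)
    (hcard : (Finset.univ.filter (fun i : Fin (n + 1) => s i = true)).card ≤ n - 2)
    (he : ∀ i j k : Fin (n + 1), (i : ℕ) < (j : ℕ) → (j : ℕ) < (k : ℕ) →
      (s i || s j || s k) = (s' i || s' j || s' k)) (i : Fin (n + 1)) (hi : s i = false) :
    s' i = false := by
  have h1 := Finset.card_filter_add_card_filter_not (s := (Finset.univ : Finset (Fin (n + 1))))
    (fun i : Fin (n + 1) => s i = true)
  rw [Finset.card_univ, Fintype.card_fin] at h1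
  have hmem : i ∈ Finset.univ.filter (fun i : Fin (n + 1) => ¬ s i = true) := by simp [hi]
  have h2 := Finset.card_erase_of_mem hmem
  obtain ⟨j, hj, k, hk, hjk⟩ := Finset.one_lt_card.1
    (show 1 < ((Finset.univ.filter (fun i : Fin (n + 1) => ¬ s i = true)).erase i).card by omega)
  simp only [Finset.mem_erase, Finset.mem_filter, Finset.mem_univ, true_and,
    Bool.not_eq_true] at hj hk
  obtain ⟨hji, hj⟩ := hj
  obtain ⟨hki, hk⟩ := hk
  have a1 := he i j k
  have a2 := he i k j
  have a3 := he j i k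
  have a4 := he j k i
  have a5 := he k i j
  have a6 := he k j i
  simp only [hi, hj, hk] at a1 a2 a3 a4 a5 a6
  have b1 : (i : ℕ) ≠ j := fun h => hji (Fin.ext h.symm)
  have b2 : (i : ℕ) ≠ k := fun h => hki (Fin.ext h.symm)
  have b3 : (j : ℕ) ≠ k := fun h => hjk (Fin.ext h)
  cases h : s' i
  · rfl
  · simp [h] at a1 a2 a3 a4 a5 a6
    omega

/-- Correctness of the identification scheme: if two state vectors `s` and `s'` on
`n + 1` sensors each have at most `n - 2` attacked sensors, and all their disparity
error states `s i || s j || s k` (for `i < j < k`) agree, then `s = s'`. -/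
theorem stmt_5 (n : ℕ) (hn : 3 ≤ n) (s s' : Fin (n + 1) → Bool)
    (hcard : (Finset.univ.filter (fun i : Fin (n + 1) => s i = true)).card ≤ n - 2)
    (hcard' : (Finset.univ.filter (fun i : Fin (n + 1) => s' i = true)).card ≤ n - 2)
    (he : ∀ i j k : Fin (n + 1), (i : ℕ) < (j : ℕ) → (j : ℕ) < (k : ℕ) →
      (s i || s j || s k) = (s' i || s' j || s' k)) :
    s = s' := by
  funext i
  have h1 := aux_false n hn s s' hcard he i
  have h2 := aux_false n hn s' s hcard' (fun i j k a b => (he i j k a b).symm) i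
  cases h : s i
  · exact (h1 h).symm
  · cases h' : s' i
    · rw [h2 h'] at h
      exact h.symm
    · rfl
end

section
/- Let n ≥ 3 and let s_0, …, s_n be the Boolean states of n+1 sensors, with the number of attacked sensors (the cardinality of {i : s_i = true}) at most n − 2. Then for every index i ∈ {0, …, n}: s_i = false if and only if there exist indices j and k, with i, j, k pairwise distinct, such that s_i ∨ s_j ∨ s_k = false. Equivalently, sensor i is attacked if and only if every three-sensor combination containing S_i has disparity error state equal to true. (The explicit recovery rule underlying the paper's identification algorithm.) -/
/-- Explicit recovery rule underlying the identification algorithm: if at most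
`n - 2` of the `n + 1` sensors are attacked, then sensor `i` is normal iff some
three-sensor combination containing `S_i` has disparity error state `false`. -/
theorem stmt_6 (n : ℕ) (hn : 3 ≤ n) (s : Fin (n + 1) → Bool)
    (hcard : (Finset.univ.filter (fun i : Fin (n + 1) => s i = true)).card ≤ n - 2) :
    ∀ i : Fin (n + 1), s i = false ↔
      ∃ j k : Fin (n + 1), i ≠ j ∧ i ≠ k ∧ j ≠ k ∧
        (s i || s j || s k) = false := by
  intro i
  constructor
  · intro hi
    have h1 := Finset.card_filter_add_card_filter_not (s := (Finset.univ : Finset (Fin (n + 1))))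
      (fun i : Fin (n + 1) => s i = true)
    rw [Finset.card_univ, Fintype.card_fin] at h1
    have h2 : i ∈ Finset.univ.filter (fun i : Fin (n + 1) => ¬ s i = true) := by simp [hi]
    have h3 := Finset.card_erase_of_mem h2
    have h4 : 1 < ((Finset.univ.filter (fun i : Fin (n + 1) => ¬ s i = true)).erase i).card := by
      omega
    obtain ⟨j, hj, k, hk, hjk⟩ := Finset.one_lt_card.mp h4
    simp at hj hk
    exact ⟨j, k, fun h => hj.1 h.symm, fun h => hk.1 h.symm, hjk, by simp [hi, hj.2, hk.2]⟩
  · rintro ⟨j, k, -, -, -, h⟩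
    simp at h
    exact h.1.1
end

section
/- For every n ≥ 3 there exist two distinct Boolean state vectors s ≠ s' on the n+1 sensors S_0, …, S_n, each having exactly n − 1 attacked sensors, such that for all indices i < j < k in {0, …, n} the disparity error states agree: s_i ∨ s_j ∨ s_k = s'_i ∨ s'_j ∨ s'_k (indeed both equal true for every triple). Consequently, the bound of n − 2 simultaneously attacked sensors in the identification scheme cannot be improved: the disparity error states do not determine the attacked set once n − 1 or more sensors may be attacked. -/
theorem card_aux (n : ℕ) (a b : Fin (n + 1)) (hab : a ≠ b) :
    (Finset.univ.filter (fun i : Fin (n + 1) => decide (i ≠ a ∧ i ≠ b) = true)).card = n - 1 := by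
  have h : Finset.univ.filter (fun i : Fin (n + 1) => decide (i ≠ a ∧ i ≠ b) = true)
      = ({a, b} : Finset (Fin (n + 1)))ᶜ := by
    ext i
    simp
  rw [h, Finset.card_compl, Finset.card_pair hab, Fintype.card_fin]
  omega

theorem or_aux (n : ℕ) (a b i j k : Fin (n + 1)) (hij : (i : ℕ) < (j : ℕ))
    (hjk : (j : ℕ) < (k : ℕ)) :
    (decide (i ≠ a ∧ i ≠ b) || decide (j ≠ a ∧ j ≠ b) || decide (k ≠ a ∧ k ≠ b)) = true := by
  simp only [Bool.or_eq_true, decide_eq_true_eq, ne_eq, Fin.ext_iff]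
  omega

/-- Sharpness of the `n - 2` bound: for every `n ≥ 3` there are two distinct state
vectors, each with exactly `n - 1` attacked sensors, whose disparity error states
agree on every triple `i < j < k` (indeed every such state equals `true`). -/
theorem stmt_7 (n : ℕ) (hn : 3 ≤ n) :
    ∃ s s' : Fin (n + 1) → Bool, s ≠ s' ∧
      (Finset.univ.filter (fun i : Fin (n + 1) => s i = true)).card = n - 1 ∧
      (Finset.univ.filter (fun i : Fin (n + 1) => s' i = true)).card = n - 1 ∧
      ∀ i j k : Fin (n + 1), (i : ℕ) < (j : ℕ) → (j : ℕ) < (k : ℕ) →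
        (s i || s j || s k) = (s' i || s' j || s' k) ∧
        (s i || s j || s k) = true ∧ (s' i || s' j || s' k) = true := by
  have h01 : (⟨0, by omega⟩ : Fin (n + 1)) ≠ ⟨1, by omega⟩ := by simp
  have h02 : (⟨0, by omega⟩ : Fin (n + 1)) ≠ ⟨2, by omega⟩ := by simp
  refine ⟨fun i => decide (i ≠ ⟨0, by omega⟩ ∧ i ≠ ⟨1, by omega⟩),
    fun i => decide (i ≠ ⟨0, by omega⟩ ∧ i ≠ ⟨2, by omega⟩), ?_,
    card_aux n _ _ h01, card_aux n _ _ h02, ?_⟩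
  · intro h
    have h1 := congrFun h ⟨1, by omega⟩
    simp at h1
  · intro i j k hij hjk
    have h1 := or_aux n ⟨0, by omega⟩ ⟨1, by omega⟩ i j k hij hjk
    have h2 := or_aux n ⟨0, by omega⟩ ⟨2, by omega⟩ i j k hij hjk
    exact ⟨h1.trans h2.symm, h1, h2⟩
end
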